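/- arXiv:1507.05128 — 9 statements merged into one kernel-verified Lean document; each statement's English description precedes it below -/
import Mathlib

section
/- Let K be a real symmetric positive definite n×n matrix, k ∈ ℝⁿ, k00 > 0 with 0 < kᵀK⁻¹k, and set ρ := √(kᵀK⁻¹k / k00). Then for every y ∈ ℝⁿ and β ∈ ℝ, |(1/ρ) · kᵀK⁻¹(y − β·1)| ≤ √k00 · √((y − β·1)ᵀK⁻¹(y − β·1)), where 1 denotes the all-ones vector in ℝⁿ. In particular, the deviation of the SiNK predictor β + (1/ρ)kᵀK⁻¹(y − β·1) from β is bounded by a quantity not depending on k. -/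
open Matrix

/-- Cauchy–Schwarz inequality for the bilinear form of a real positive semidefinite matrix. -/
theorem Matrix.PosSemidef.sq_dotProduct_mulVec_le {ι : Type*} [Fintype ι] {M : Matrix ι ι ℝ}
    (hM : M.PosSemidef) (u v : ι → ℝ) :
    (u ⬝ᵥ (M *ᵥ v)) ^ 2 ≤ (u ⬝ᵥ (M *ᵥ u)) * (v ⬝ᵥ (M *ᵥ v)) := by
  have hsymm : v ⬝ᵥ (M *ᵥ u) = u ⬝ᵥ (M *ᵥ v) := by
    have hT : Mᵀ = M := by simpa using hM.isHermitian.eq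
    rw [dotProduct_mulVec, ← mulVec_transpose, hT, dotProduct_comm]
  have h := discrim_le_zero (a := u ⬝ᵥ (M *ᵥ u)) (b := 2 * (u ⬝ᵥ (M *ᵥ v)))
    (c := v ⬝ᵥ (M *ᵥ v)) fun t => by
      have h0 := hM.dotProduct_mulVec_nonneg (t • u + v)
      simp only [star_trivial, mulVec_add, mulVec_smul, dotProduct_add, add_dotProduct,
        smul_dotProduct, dotProduct_smul, smul_eq_mul, hsymm] at h0
      linarith
  rw [discrim] at h
  linarith

/-- Boundedness of the SiNK predictor: the deviation of the SiNK prediction from the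
prior mean `β` is bounded by `√k00 · √((y − β·1)ᵀ K⁻¹ (y − β·1))`. -/
theorem sink_boundedness (n : ℕ) (K : Matrix (Fin n) (Fin n) ℝ) (hK : K.PosDef)
    (k : Fin n → ℝ) (k00 : ℝ) (hk00 : 0 < k00)
    (hkpos : 0 < k ⬝ᵥ (K⁻¹ *ᵥ k))
    (ρ : ℝ) (hρ : ρ = Real.sqrt ((k ⬝ᵥ (K⁻¹ *ᵥ k)) / k00))
    (y : Fin n → ℝ) (β : ℝ) :
    |(1 / ρ) * (k ⬝ᵥ (K⁻¹ *ᵥ (y - β • (1 : Fin n → ℝ))))| ≤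
      Real.sqrt k00 *
        Real.sqrt ((y - β • (1 : Fin n → ℝ)) ⬝ᵥ (K⁻¹ *ᵥ (y - β • (1 : Fin n → ℝ)))) := by
  have hcs := Real.abs_le_sqrt
    (hK.inv.posSemidef.sq_dotProduct_mulVec_le k (y - β • (1 : Fin n → ℝ)))
  rw [Real.sqrt_mul hkpos.le] at hcs
  have ha := Real.sqrt_pos.mpr hkpos
  rw [hρ, Real.sqrt_div hkpos.le, one_div_div, abs_mul, abs_of_nonneg (by positivity),
    div_mul_eq_mul_div, mul_div_assoc]
  gcongr
  rwa [div_le_iff₀' ha]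
end

section
/- Let K be a real symmetric positive definite n×n matrix, k ∈ ℝⁿ with k ≠ 0, k00 > 0 with kᵀK⁻¹k < k00, β ∈ ℝ, y ∈ ℝⁿ. Define m̃(y0) := β·1 + k00⁻¹(y0 − β)·k and K̃ := K − k00⁻¹·k·kᵀ. Then the conditional log-likelihood function l(y0) := −(1/2)·(y − m̃(y0))ᵀ K̃⁻¹ (y − m̃(y0)) has a unique global maximizer over y0 ∈ ℝ, namely y0 = β + (1/ρ²)·kᵀK⁻¹(y − β·1), where ρ² := kᵀK⁻¹k / k00. (This maximizer is the CMLE predictor.) -/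
open Matrix

/-- The Sherman–Morrison formula for a symmetric rank-one downdate. -/
theorem inv_sub_smul_vecMulVec_self {n : ℕ} {K : Matrix (Fin n) (Fin n) ℝ} (hK : K.PosDef)
    (k : Fin n → ℝ) {a : ℝ} (ha : a ≠ 0) (hne : a - k ⬝ᵥ (K⁻¹ *ᵥ k) ≠ 0) :
    (K - a⁻¹ • vecMulVec k k)⁻¹ =
      K⁻¹ + (a - k ⬝ᵥ (K⁻¹ *ᵥ k))⁻¹ • vecMulVec (K⁻¹ *ᵥ k) (K⁻¹ *ᵥ k) := by
  have hdet : IsUnit K.det := (Matrix.isUnit_iff_isUnit_det K).1 hK.isUnit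
  have hsymm : K⁻¹ᵀ = K⁻¹ := by
    simpa [IsHermitian, conjTranspose_eq_transpose_of_trivial] using hK.inv.isHermitian
  have hvec : k ᵥ* K⁻¹ = K⁻¹ *ᵥ k := by rw [← mulVec_transpose, hsymm]
  apply Matrix.inv_eq_right_inv
  have hKu : K *ᵥ (K⁻¹ *ᵥ k) = k := by
    rw [mulVec_mulVec, mul_nonsing_inv _ hdet, one_mulVec]
  rw [sub_mul, mul_add, mul_add, mul_nonsing_inv _ hdet, mul_smul_comm, mul_vecMulVec, hKu,
    smul_mul_assoc, vecMulVec_mul, hvec, mul_smul_comm, smul_mul_assoc, vecMulVec_mul_vecMulVec]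
  generalize k ⬝ᵥ (K⁻¹ *ᵥ k) = q at *
  ext i j
  simp only [Matrix.sub_apply, Matrix.add_apply, Matrix.smul_apply, vecMulVec_apply, smul_eq_mul, Pi.smul_apply]
  field_simp
  ring

/-- The quadratic form of the downdated inverse along the line `t ↦ w - t • k`. -/
theorem dotProduct_inv_sub_smul_vecMulVec_self {n : ℕ} {K : Matrix (Fin n) (Fin n) ℝ}
    (hK : K.PosDef) (k w : Fin n → ℝ) {a : ℝ} (ha : a ≠ 0)
    (hne : a - k ⬝ᵥ (K⁻¹ *ᵥ k) ≠ 0) (t : ℝ) :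
    (w - t • k) ⬝ᵥ ((K - a⁻¹ • vecMulVec k k)⁻¹ *ᵥ (w - t • k)) =
      w ⬝ᵥ (K⁻¹ *ᵥ w) - 2 * t * (k ⬝ᵥ (K⁻¹ *ᵥ w)) + t ^ 2 * (k ⬝ᵥ (K⁻¹ *ᵥ k)) +
        (a - k ⬝ᵥ (K⁻¹ *ᵥ k))⁻¹ * (k ⬝ᵥ (K⁻¹ *ᵥ w) - t * (k ⬝ᵥ (K⁻¹ *ᵥ k))) ^ 2 := by
  have hsymm : K⁻¹ᵀ = K⁻¹ := by
    simpa [IsHermitian, conjTranspose_eq_transpose_of_trivial] using hK.inv.isHermitian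
  have hcomm : w ⬝ᵥ (K⁻¹ *ᵥ k) = k ⬝ᵥ (K⁻¹ *ᵥ w) := by
    rw [dotProduct_mulVec, ← mulVec_transpose, hsymm, dotProduct_comm]
  rw [inv_sub_smul_vecMulVec_self hK k ha hne]
  simp only [add_mulVec, smul_mulVec, vecMulVec_mulVec, mulVec_sub, mulVec_smul, dotProduct_add,
    dotProduct_sub, sub_dotProduct, dotProduct_smul, smul_dotProduct, smul_eq_mul, op_smul_eq_smul,
    dotProduct_comm (K⁻¹ *ᵥ k), hcomm]
  ring

/-- The conditional log-likelihood `l(y0) = −(1/2)(y − m̃(y0))ᵀ K̃⁻¹ (y − m̃(y0))`, where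
`m̃(y0) = β·1 + k00⁻¹(y0 − β)·k` and `K̃ = K − k00⁻¹ k kᵀ`, has a unique global maximizer,
namely the CMLE `ŷ0 = β + (1/ρ²)·kᵀK⁻¹(y − β·1)` with `ρ² = kᵀK⁻¹k / k00`. -/
theorem cmle_unique_maximizer (n : ℕ) (K : Matrix (Fin n) (Fin n) ℝ) (hK : K.PosDef)
    (k : Fin n → ℝ) (hk : k ≠ 0) (k00 : ℝ) (hk00 : 0 < k00)
    (hlt : k ⬝ᵥ (K⁻¹ *ᵥ k) < k00) (β : ℝ) (y : Fin n → ℝ)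
    (l : ℝ → ℝ)
    (hl : l = fun y0 =>
      -(1/2) * ((y - (β • (1 : Fin n → ℝ) + (k00⁻¹ * (y0 - β)) • k)) ⬝ᵥ
        ((K - k00⁻¹ • Matrix.vecMulVec k k)⁻¹ *ᵥ
          (y - (β • (1 : Fin n → ℝ) + (k00⁻¹ * (y0 - β)) • k)))))
    (yhat : ℝ)
    (hyhat : yhat = β + (1 / ((k ⬝ᵥ (K⁻¹ *ᵥ k)) / k00)) *
      (k ⬝ᵥ (K⁻¹ *ᵥ (y - β • (1 : Fin n → ℝ))))) :
    ∀ y0 : ℝ, y0 ≠ yhat → l y0 < l yhat := by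
  intro y0 hy0
  have hq : 0 < k ⬝ᵥ (K⁻¹ *ᵥ k) := by simpa using hK.inv.dotProduct_mulVec_pos hk
  have hgap : 0 < k00 - k ⬝ᵥ (K⁻¹ *ᵥ k) := sub_pos.2 hlt
  subst hl
  simp only [← sub_sub]
  rw [dotProduct_inv_sub_smul_vecMulVec_self hK k _ hk00.ne' hgap.ne',
    dotProduct_inv_sub_smul_vecMulVec_self hK k _ hk00.ne' hgap.ne']
  generalize k ⬝ᵥ (K⁻¹ *ᵥ k) = q at *
  generalize k ⬝ᵥ (K⁻¹ *ᵥ (y - β • (1 : Fin n → ℝ))) = s at *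
  have hs : s = k00⁻¹ * (yhat - β) * q := by
    rw [hyhat]
    field_simp
    ring
  have hc := inv_pos.2 hgap
  have hd : 0 < (k00⁻¹ * (y0 - yhat)) ^ 2 :=
    sq_pos_of_ne_zero (mul_ne_zero (inv_ne_zero hk00.ne') (sub_ne_zero.2 hy0))
  have hpos : 0 < (q + (k00 - q)⁻¹ * q ^ 2) * (k00⁻¹ * (y0 - yhat)) ^ 2 := by positivity
  rw [hs]
  linarith
end

section
/- Let K be a real symmetric positive definite n×n matrix, k ∈ ℝⁿ, k00 > 0 with 0 < kᵀK⁻¹k < k00, β ∈ ℝ, y ∈ ℝⁿ, and ρ := √(kᵀK⁻¹k / k00). Define m̃(y0) := β·1 + k00⁻¹(y0 − β)·k and K̃ := K − k00⁻¹·k·kᵀ. Then the penalized conditional log-likelihood y0 ↦ −(1/2)(y − m̃(y0))ᵀK̃⁻¹(y − m̃(y0)) − (ρ/(2(1+ρ)))·(y0 − β)²/k00 has a unique global maximizer over y0 ∈ ℝ, namely y0 = β + (1/ρ)·kᵀK⁻¹(y − β·1). (This maximizer is the SiNK predictor.) -/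
open Matrix

/-- Sherman–Morrison formula for the symmetric rank-one downdate `K - c⁻¹ k kᵀ`. -/
theorem inv_sub_smul_vecMulVec {ι : Type*} [Fintype ι] [DecidableEq ι] {K : Matrix ι ι ℝ}
    (hK : IsUnit K.det) (hsymm : K⁻¹ᵀ = K⁻¹) (k : ι → ℝ) {c : ℝ} (hc : c ≠ 0)
    (hne : c - k ⬝ᵥ (K⁻¹ *ᵥ k) ≠ 0) :
    (K - c⁻¹ • vecMulVec k k)⁻¹ =
      K⁻¹ + (c - k ⬝ᵥ (K⁻¹ *ᵥ k))⁻¹ • vecMulVec (K⁻¹ *ᵥ k) (K⁻¹ *ᵥ k) := by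
  have hvec : k ᵥ* K⁻¹ = K⁻¹ *ᵥ k := by
    rw [← mulVec_transpose, hsymm]
  apply inv_eq_right_inv
  have hKk : K *ᵥ (K⁻¹ *ᵥ k) = k := by
    rw [mulVec_mulVec, mul_nonsing_inv K hK, one_mulVec]
  rw [sub_mul, mul_add, mul_add, mul_nonsing_inv K hK, Matrix.mul_smul, Matrix.smul_mul,
    Matrix.smul_mul, Matrix.mul_smul, mul_vecMulVec, hKk, vecMulVec_mul, hvec,
    vecMulVec_mul_vecMulVec]
  set q := k ⬝ᵥ (K⁻¹ *ᵥ k)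
  ext i j
  simp only [Matrix.add_apply, Matrix.sub_apply, Matrix.smul_apply, vecMulVec_apply, smul_eq_mul,
    Pi.smul_apply]
  field_simp
  ring

/-- The quadratic form of the inverse of a symmetric rank-one downdate. -/
theorem dotProduct_inv_sub_smul_vecMulVec_mulVec {ι : Type*} [Fintype ι] [DecidableEq ι]
    {K : Matrix ι ι ℝ} (hK : IsUnit K.det) (hsymm : K⁻¹ᵀ = K⁻¹) (k : ι → ℝ) {c : ℝ} (hc : c ≠ 0)
    (hne : c - k ⬝ᵥ (K⁻¹ *ᵥ k) ≠ 0) (w : ι → ℝ) :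
    w ⬝ᵥ ((K - c⁻¹ • vecMulVec k k)⁻¹ *ᵥ w) =
      w ⬝ᵥ (K⁻¹ *ᵥ w) + (c - k ⬝ᵥ (K⁻¹ *ᵥ k))⁻¹ * (k ⬝ᵥ (K⁻¹ *ᵥ w)) ^ 2 := by
  have hkw : (K⁻¹ *ᵥ k) ⬝ᵥ w = k ⬝ᵥ (K⁻¹ *ᵥ w) := by
    rw [dotProduct_mulVec, ← mulVec_transpose, hsymm]
  rw [inv_sub_smul_vecMulVec hK hsymm k hc hne, add_mulVec, smul_mulVec, vecMulVec_mulVec,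
    dotProduct_add, dotProduct_smul, dotProduct_smul, hkw, dotProduct_comm w (K⁻¹ *ᵥ k), hkw]
  simp only [smul_eq_mul, MulOpposite.smul_eq_mul_unop, MulOpposite.unop_op]
  ring

/-- The penalized conditional log-likelihood
`y0 ↦ −(1/2)(y − m̃(y0))ᵀ K̃⁻¹ (y − m̃(y0)) − (ρ/(2(1+ρ)))·(y0 − β)²/k00`, where
`m̃(y0) = β·1 + k00⁻¹(y0 − β)·k` and `K̃ = K − k00⁻¹ k kᵀ`, has a unique global maximizer,
namely the SiNK predictor `ŷ0 = β + (1/ρ)·kᵀK⁻¹(y − β·1)` with `ρ = √(kᵀK⁻¹k / k00)`. -/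
theorem sink_unique_maximizer (n : ℕ) (K : Matrix (Fin n) (Fin n) ℝ) (hK : K.PosDef)
    (k : Fin n → ℝ) (k00 : ℝ) (hk00 : 0 < k00)
    (hpos : 0 < k ⬝ᵥ (K⁻¹ *ᵥ k)) (hlt : k ⬝ᵥ (K⁻¹ *ᵥ k) < k00)
    (β : ℝ) (y : Fin n → ℝ)
    (ρ : ℝ) (hρ : ρ = Real.sqrt ((k ⬝ᵥ (K⁻¹ *ᵥ k)) / k00))
    (l : ℝ → ℝ)
    (hl : l = fun y0 =>
      -(1/2) * ((y - (β • (1 : Fin n → ℝ) + (k00⁻¹ * (y0 - β)) • k)) ⬝ᵥ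
        ((K - k00⁻¹ • Matrix.vecMulVec k k)⁻¹ *ᵥ
          (y - (β • (1 : Fin n → ℝ) + (k00⁻¹ * (y0 - β)) • k))))
      - (ρ / (2 * (1 + ρ))) * (y0 - β)^2 / k00)
    (yhat : ℝ)
    (hyhat : yhat = β + (1 / ρ) *
      (k ⬝ᵥ (K⁻¹ *ᵥ (y - β • (1 : Fin n → ℝ))))) :
    ∀ y0 : ℝ, y0 ≠ yhat → l y0 < l yhat := by
  have hdet : IsUnit K.det := hK.det_pos.ne'.isUnit
  have hsymm : K⁻¹ᵀ = K⁻¹ := by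
    have h := hK.isHermitian.inv.eq
    rwa [conjTranspose_eq_transpose_of_trivial] at h
  have hne : k00 - k ⬝ᵥ (K⁻¹ *ᵥ k) ≠ 0 := (sub_pos.2 hlt).ne'
  have hρ_pos : 0 < ρ := hρ ▸ Real.sqrt_pos.2 (div_pos hpos hk00)
  have hq : k ⬝ᵥ (K⁻¹ *ᵥ k) = ρ ^ 2 * k00 := by
    rw [hρ, Real.sq_sqrt (div_pos hpos hk00).le, div_mul_cancel₀ _ hk00.ne']
  have hρ_lt : ρ < 1 := by
    have h : ρ ^ 2 < 1 := by
      rw [hq] at hlt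
      exact lt_of_mul_lt_mul_right (by rwa [one_mul]) hk00.le
    nlinarith
  set z := y - β • (1 : Fin n → ℝ) with hz
  have hzk : z ⬝ᵥ (K⁻¹ *ᵥ k) = k ⬝ᵥ (K⁻¹ *ᵥ z) := by
    rw [dotProduct_mulVec, ← mulVec_transpose, hsymm, dotProduct_comm]
  have hform (y0 : ℝ) : l y0 =
      -(1 / 2) * (z ⬝ᵥ (K⁻¹ *ᵥ z) - 2 * (k00⁻¹ * (y0 - β)) * (k ⬝ᵥ (K⁻¹ *ᵥ z))
        + (k00⁻¹ * (y0 - β)) ^ 2 * (ρ ^ 2 * k00)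
        + (k00 - ρ ^ 2 * k00)⁻¹ *
          (k ⬝ᵥ (K⁻¹ *ᵥ z) - k00⁻¹ * (y0 - β) * (ρ ^ 2 * k00)) ^ 2)
      - (ρ / (2 * (1 + ρ))) * (y0 - β) ^ 2 / k00 := by
    simp only [hl]
    rw [dotProduct_inv_sub_smul_vecMulVec_mulVec hdet hsymm k hk00.ne' hne, ← sub_sub, ← hz]
    simp only [mulVec_sub, mulVec_smul, dotProduct_sub, sub_dotProduct, dotProduct_smul,
      smul_dotProduct, smul_eq_mul, hzk, hq]
    ring
  intro y0 hy0
  have hgap : l yhat - l y0 = ρ / (2 * k00 * (1 - ρ ^ 2)) * (y0 - yhat) ^ 2 := by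
    rw [hform, hform, hyhat]
    have h1 : 1 - ρ ≠ 0 := (sub_pos.2 hρ_lt).ne'
    have h2 : 1 + ρ ≠ 0 := by positivity
    rw [show k00 - ρ ^ 2 * k00 = k00 * ((1 - ρ) * (1 + ρ)) by ring,
      show 1 - ρ ^ 2 = (1 - ρ) * (1 + ρ) by ring]
    field_simp
    ring
  have hcoef : 0 < 1 - ρ ^ 2 := by nlinarith
  have hsq : 0 < (y0 - yhat) ^ 2 := sq_pos_of_ne_zero (sub_ne_zero.2 hy0)
  rw [← sub_pos, hgap]
  positivity
end

section
/- Let K be a real symmetric positive definite n×n matrix, k ∈ ℝⁿ, k00 > 0 with kᵀK⁻¹k ≤ k00, ρ² := kᵀK⁻¹k / k00, and let δ ≥ 0. Then the function λ ↦ k00 − 2λᵀk + λᵀKλ + δ·k00·(1 − λᵀk/k00)² on ℝⁿ has a unique global minimizer, namely λ = ((δ+1)/(δρ²+1))·K⁻¹k. -/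
open Matrix

/-- The CBPK objective `λ ↦ k00 − 2λᵀk + λᵀKλ + δ·k00·(1 − λᵀk/k00)²` has a unique global
minimizer, namely `λ = ((δ+1)/(δρ²+1))·K⁻¹k` with `ρ² = kᵀK⁻¹k / k00`. -/
theorem cbpk_unique_minimizer (n : ℕ) (K : Matrix (Fin n) (Fin n) ℝ) (hK : K.PosDef)
    (k : Fin n → ℝ) (k00 : ℝ) (hk00 : 0 < k00)
    (hle : k ⬝ᵥ (K⁻¹ *ᵥ k) ≤ k00) (δ : ℝ) (hδ : 0 ≤ δ)
    (f : (Fin n → ℝ) → ℝ)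
    (hf : f = fun lam => k00 - 2 * (lam ⬝ᵥ k) + lam ⬝ᵥ (K *ᵥ lam)
      + δ * k00 * (1 - (lam ⬝ᵥ k) / k00)^2)
    (lamhat : Fin n → ℝ)
    (hlam : lamhat = ((δ + 1) / (δ * ((k ⬝ᵥ (K⁻¹ *ᵥ k)) / k00) + 1)) • (K⁻¹ *ᵥ k)) :
    ∀ lam : Fin n → ℝ, lam ≠ lamhat → f lamhat < f lam := by
  intro lam hne
  have hdet : IsUnit K.det := (Matrix.isUnit_iff_isUnit_det K).mp hK.isUnit
  have hq : 0 ≤ k ⬝ᵥ (K⁻¹ *ᵥ k) := by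
    simpa using hK.inv.posSemidef.dotProduct_mulVec_nonneg k
  have hKw : K *ᵥ (K⁻¹ *ᵥ k) = k := by
    rw [Matrix.mulVec_mulVec, Matrix.mul_nonsing_inv K hdet, Matrix.one_mulVec]
  have hKt : Kᵀ = K := by simpa using hK.isHermitian.eq
  generalize K⁻¹ *ᵥ k = w at *
  obtain ⟨d, rfl⟩ : ∃ d, lam = lamhat + d := ⟨lam - lamhat, by simp⟩
  have hpos : 0 < d ⬝ᵥ (K *ᵥ d) := by
    simpa using hK.dotProduct_mulVec_pos (x := d) (by simpa using hne)
  have hwd : w ⬝ᵥ (K *ᵥ d) = d ⬝ᵥ k := by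
    rw [Matrix.dotProduct_mulVec, ← Matrix.mulVec_transpose, hKt, hKw, dotProduct_comm]
  have hwk : w ⬝ᵥ k = k ⬝ᵥ w := dotProduct_comm w k
  have hden : 0 < δ * ((k ⬝ᵥ w) / k00) + 1 := by positivity
  generalize hc : (δ + 1) / (δ * ((k ⬝ᵥ w) / k00) + 1) = c at hlam
  have hstat : c = 1 + δ * (1 - c * (k ⬝ᵥ w) / k00) := by
    have hmul := (div_eq_iff hden.ne').mp hc
    linear_combination -hmul
  subst hlam hf
  simp only [add_dotProduct, Matrix.mulVec_add, dotProduct_add, smul_dotProduct,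
    Matrix.mulVec_smul, dotProduct_smul, hKw, hwd, hwk, smul_eq_mul]
  generalize k ⬝ᵥ w = q at *
  generalize d ⬝ᵥ k = t at *
  generalize d ⬝ᵥ (K *ᵥ d) = p at *
  have hrest : 0 ≤ δ * t ^ 2 / k00 := by positivity
  have hexpand : δ * k00 * (1 - (c * q + t) / k00) ^ 2
      = δ * k00 * (1 - c * q / k00) ^ 2 - 2 * t * (δ * (1 - c * q / k00))
        + δ * t ^ 2 / k00 := by
    field_simp
    ring
  rw [hexpand]
  linear_combination hpos + hrest - 2 * t * hstat
end

section
/- Let K be a real symmetric positive definite n×n matrix, k ∈ ℝⁿ, k00 > 0 with 0 < kᵀK⁻¹k ≤ k00, and ρ := √(kᵀK⁻¹k / k00) ∈ (0,1]. Then the unique global minimizer of λ ↦ k00 − 2λᵀk + λᵀKλ + (1/ρ)·k00·(1 − λᵀk/k00)² over λ ∈ ℝⁿ is λ = (1/ρ)·K⁻¹k. That is, the SiNK predictor β + (1/ρ)kᵀK⁻¹(y − β·1) is the Conditional Bias-Penalized Kriging predictor with penalty ratio δ = 1/ρ. -/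
open Matrix

/-- Expansion of a symmetric quadratic form around a point. -/
theorem dotProduct_mulVec_add_self {ι R : Type*} [Fintype ι] [CommRing R]
    {K : Matrix ι ι R} (hK : K.IsSymm) (a d : ι → R) :
    (a + d) ⬝ᵥ (K *ᵥ (a + d)) = a ⬝ᵥ (K *ᵥ a) + 2 * (d ⬝ᵥ (K *ᵥ a)) + d ⬝ᵥ (K *ᵥ d) := by
  have hcomm : a ⬝ᵥ (K *ᵥ d) = d ⬝ᵥ (K *ᵥ a) := by
    rw [dotProduct_mulVec, ← mulVec_transpose, hK.eq, dotProduct_comm]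
  rw [mulVec_add, add_dotProduct, dotProduct_add, dotProduct_add, hcomm]
  ring

/-- The SiNK predictor is the CBPK predictor with penalty ratio `δ = 1/ρ`: the objective
`λ ↦ k00 − 2λᵀk + λᵀKλ + (1/ρ)·k00·(1 − λᵀk/k00)²` has unique global minimizer
`λ = (1/ρ)·K⁻¹k`, where `ρ = √(kᵀK⁻¹k / k00) ∈ (0,1]`. -/
theorem sink_is_cbpk (n : ℕ) (K : Matrix (Fin n) (Fin n) ℝ) (hK : K.PosDef)
    (k : Fin n → ℝ) (k00 : ℝ) (hk00 : 0 < k00)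
    (hpos : 0 < k ⬝ᵥ (K⁻¹ *ᵥ k)) (hle : k ⬝ᵥ (K⁻¹ *ᵥ k) ≤ k00)
    (ρ : ℝ) (hρ : ρ = Real.sqrt ((k ⬝ᵥ (K⁻¹ *ᵥ k)) / k00))
    (f : (Fin n → ℝ) → ℝ)
    (hf : f = fun lam => k00 - 2 * (lam ⬝ᵥ k) + lam ⬝ᵥ (K *ᵥ lam)
      + (1 / ρ) * k00 * (1 - (lam ⬝ᵥ k) / k00)^2) :
    ρ ∈ Set.Ioc (0 : ℝ) 1 ∧
    ∀ lam : Fin n → ℝ, lam ≠ (1 / ρ) • (K⁻¹ *ᵥ k) →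
      f ((1 / ρ) • (K⁻¹ *ᵥ k)) < f lam := by
  have hρpos : 0 < ρ := hρ ▸ Real.sqrt_pos.2 (div_pos hpos hk00)
  have hq : k ⬝ᵥ (K⁻¹ *ᵥ k) = ρ ^ 2 * k00 := by
    rw [hρ, Real.sq_sqrt (div_pos hpos hk00).le, div_mul_cancel₀ _ hk00.ne']
  refine ⟨⟨hρpos, hρ ▸ Real.sqrt_le_one.2 ((div_le_one hk00).2 hle)⟩, fun lam hne => ?_⟩
  set a : Fin n → ℝ := (1 / ρ) • (K⁻¹ *ᵥ k) with ha
  obtain ⟨d, rfl⟩ : ∃ d, lam = a + d := ⟨lam - a, by simp⟩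
  have hd : d ≠ 0 := by
    rintro rfl
    exact hne (add_zero a)
  have hKa : K *ᵥ a = (1 / ρ) • k := by
    rw [ha, mulVec_smul, mulVec_mulVec,
      mul_nonsing_inv _ ((isUnit_iff_isUnit_det K).1 hK.isUnit), one_mulVec]
  have hak : a ⬝ᵥ k = ρ * k00 := by
    rw [ha, smul_dotProduct, dotProduct_comm, hq, smul_eq_mul]
    field_simp
  have hdKd : 0 < d ⬝ᵥ (K *ᵥ d) := by
    simpa using hK.dotProduct_mulVec_pos hd
  have hsymm : K.IsSymm := by
    simpa [IsHermitian, IsSymm, conjTranspose_eq_transpose_of_trivial] using hK.isHermitian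
  have hgap : f (a + d) - f a = d ⬝ᵥ (K *ᵥ d) + (d ⬝ᵥ k) ^ 2 / (ρ * k00) := by
    simp only [hf]
    rw [dotProduct_mulVec_add_self hsymm, add_dotProduct, hKa, dotProduct_smul,
      dotProduct_smul, hak, smul_eq_mul, smul_eq_mul]
    field_simp
    ring
  have hnonneg : 0 ≤ (d ⬝ᵥ k) ^ 2 / (ρ * k00) := by positivity
  linarith
end

section
/- Let K be a real symmetric positive definite n×n matrix, k ∈ ℝⁿ with k ≠ 0, k00 > 0, ρ² := kᵀK⁻¹k/k00, β ∈ ℝ, y0 ∈ ℝ. Let y be an integrable random vector in ℝⁿ with mean m̃(y0) := β·1 + k00⁻¹(y0 − β)·k. Then the Simple Kriging predictor satisfies E[β + kᵀK⁻¹(y − β·1)] = β + ρ²·(y0 − β), whereas the CMLE predictor satisfies E[β + (1/ρ²)·kᵀK⁻¹(y − β·1)] = y0; i.e., the Kriging predictor is conditionally biased while the CMLE is conditionally unbiased. -/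
open Matrix MeasureTheory

theorem integrable_dotProduct {ι Ω : Type*} [Fintype ι] [MeasurableSpace Ω] {μ : Measure Ω}
    {X : Ω → ι → ℝ} (hX : ∀ i, Integrable (fun ω => X ω i) μ) (a : ι → ℝ) :
    Integrable (fun ω => a ⬝ᵥ X ω) μ :=
  integrable_finsetSum _ fun i _ => (hX i).const_mul (a i)

theorem integral_dotProduct {ι Ω : Type*} [Fintype ι] [MeasurableSpace Ω] {μ : Measure Ω}
    {X : Ω → ι → ℝ} (hX : ∀ i, Integrable (fun ω => X ω i) μ) (a : ι → ℝ) :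
    ∫ ω, a ⬝ᵥ X ω ∂μ = a ⬝ᵥ fun i => ∫ ω, X ω i ∂μ := by
  simp only [dotProduct]
  rw [integral_finsetSum _ fun i _ => (hX i).const_mul (a i)]
  simp only [integral_const_mul]

/-- Conditional bias: if the data vector `y` has conditional mean
`m̃(y0) = β·1 + k00⁻¹(y0 − β)·k`, then the Simple Kriging predictor has expectation
`β + ρ²(y0 − β)` (conditionally biased), while the CMLE predictor has expectation `y0`
(conditionally unbiased). -/
theorem kriging_conditional_bias (n : ℕ) (K : Matrix (Fin n) (Fin n) ℝ) (hK : K.PosDef)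
    (k : Fin n → ℝ) (hk : k ≠ 0) (k00 : ℝ) (hk00 : 0 < k00) (β y0 : ℝ)
    (Ω : Type*) [MeasurableSpace Ω] (μ : Measure Ω) [IsProbabilityMeasure μ]
    (Y : Ω → Fin n → ℝ)
    (hInt : ∀ i, Integrable (fun ω => Y ω i) μ)
    (hMean : ∀ i, ∫ ω, Y ω i ∂μ = β + k00⁻¹ * (y0 - β) * k i) :
    (∫ ω, (β + k ⬝ᵥ (K⁻¹ *ᵥ (Y ω - β • (1 : Fin n → ℝ)))) ∂μ
        = β + ((k ⬝ᵥ (K⁻¹ *ᵥ k)) / k00) * (y0 - β)) ∧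
    (∫ ω, (β + (1 / ((k ⬝ᵥ (K⁻¹ *ᵥ k)) / k00)) *
        (k ⬝ᵥ (K⁻¹ *ᵥ (Y ω - β • (1 : Fin n → ℝ))))) ∂μ = y0) := by
  have hpos : 0 < k ⬝ᵥ (K⁻¹ *ᵥ k) := by
    simpa using hK.inv.dotProduct_mulVec_pos hk
  have hcenter : ∀ i, Integrable (fun ω => (Y ω - β • (1 : Fin n → ℝ)) i) μ := fun i =>
    (hInt i).sub (integrable_const _)
  have hmean : (fun i => ∫ ω, (Y ω - β • (1 : Fin n → ℝ)) i ∂μ) = (k00⁻¹ * (y0 - β)) • k := by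
    funext i
    simp only [Pi.sub_apply, Pi.smul_apply, Pi.one_apply, smul_eq_mul, mul_one]
    rw [integral_sub (hInt i) (integrable_const _), hMean i]
    simp
  have hint : Integrable (fun ω => k ⬝ᵥ (K⁻¹ *ᵥ (Y ω - β • (1 : Fin n → ℝ)))) μ := by
    simp only [dotProduct_mulVec]
    exact integrable_dotProduct hcenter _
  have hval : ∫ ω, k ⬝ᵥ (K⁻¹ *ᵥ (Y ω - β • (1 : Fin n → ℝ))) ∂μ =
      ((k ⬝ᵥ (K⁻¹ *ᵥ k)) / k00) * (y0 - β) := by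
    simp only [dotProduct_mulVec]
    rw [integral_dotProduct hcenter, hmean, dotProduct_smul, smul_eq_mul]
    ring
  constructor
  · rw [integral_add (integrable_const _) hint, hval]
    simp
  · rw [integral_add (integrable_const _) (hint.const_mul _), integral_const_mul, hval,
      ← mul_assoc, one_div_mul_cancel (div_pos hpos hk00).ne']
    simp
end

section
/- Let M > 0, let φ(M) = (1/√(2π))·e^{−M²/2} and Φ(M) be the standard normal density and cumulative distribution function, and set T := (M·φ(M) + 1 − Φ(M))/(1 − Φ(M)). If ρ ∈ [0, 1] satisfies ρ ≥ −1 + √(1 + (1 − Φ(M))/(M·φ(M))), then 1 − ρ² + T·(1−ρ)² ≤ ρ² − ρ⁴ + T·(1−ρ²)². Consequently, the mean squared prediction error of SiNK conditional on the event {|Y(x0) − β|/√k00 ≥ M} is at most that of Simple Kriging whenever ρ(x0) ≥ −1 + √(1 + (1−Φ(M))/(Mφ(M))). -/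
open MeasureTheory ProbabilityTheory

/-- The cumulative distribution function of a nondegenerate Gaussian is strictly below one. -/
theorem gaussianReal_real_Iic_lt_one (μ : ℝ) {v : NNReal} (hv : v ≠ 0) (x : ℝ) :
    (gaussianReal μ v).real (Set.Iic x) < 1 := by
  have hne : gaussianReal μ v (Set.Ioi x) ≠ 0 := fun h => by
    simpa using gaussianReal_absolutelyContinuous' μ hv h
  have hpos : 0 < (gaussianReal μ v).real (Set.Ioi x) :=
    ENNReal.toReal_pos hne (measure_ne_top _ _)
  have hcompl := probReal_compl_eq_one_sub (μ := gaussianReal μ v) (measurableSet_Iic (a := x))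
  rw [Set.compl_Iic] at hcompl
  linarith

/-- If `ρ ∈ [0,1]` satisfies `ρ ≥ −1 + √(1 + (1 − Φ(M))/(M·φ(M)))`, then with
`T = (M·φ(M) + 1 − Φ(M))/(1 − Φ(M)) = E[Z² | Z > M]` we have
`1 − ρ² + T(1−ρ)² ≤ ρ² − ρ⁴ + T(1−ρ²)²`; i.e. the MSPE of SiNK conditional on
`{|Y(x0) − β|/√k00 ≥ M}` is at most that of Simple Kriging. -/
theorem sink_better_on_extreme_region (M : ℝ) (hM : 0 < M)
    (φM ΦM T : ℝ)
    (hφM : φM = (1 / Real.sqrt (2 * Real.pi)) * Real.exp (-M^2 / 2))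
    (hΦM : ΦM = ((gaussianReal 0 1) (Set.Iic M)).toReal)
    (hT : T = (M * φM + 1 - ΦM) / (1 - ΦM))
    (ρ : ℝ) (hρ : ρ ∈ Set.Icc (0 : ℝ) 1)
    (hρM : -1 + Real.sqrt (1 + (1 - ΦM) / (M * φM)) ≤ ρ) :
    1 - ρ^2 + T * (1 - ρ)^2 ≤ ρ^2 - ρ^4 + T * (1 - ρ^2)^2 := by
  have hs : 0 < 1 - ΦM := by
    rw [hΦM]
    exact sub_pos.mpr (gaussianReal_real_Iic_lt_one 0 one_ne_zero M)
  have hφ : 0 < φM := by rw [hφM]; positivity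
  have ha : 0 < M * φM := mul_pos hM hφ
  have hsq : 1 + (1 - ΦM) / (M * φM) ≤ (1 + ρ) ^ 2 :=
    (Real.sqrt_le_left (by linarith [hρ.1])).mp (by linarith)
  have hT1 : T = 1 + M * φM / (1 - ΦM) := by
    rw [hT]
    field_simp
    ring
  have hodds : 0 < T - 1 := by rw [hT1]; simpa using div_pos ha hs
  have hthreshold : T ≤ (T - 1) * (1 + ρ) ^ 2 := by
    calc T = (T - 1) * (1 + (1 - ΦM) / (M * φM)) := by
          rw [hT1]
          field_simp
          ring
      _ ≤ (T - 1) * (1 + ρ) ^ 2 := by gcongr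
  linear_combination (1 - ρ) ^ 2 * hthreshold
end

section
/- Let C : [0,∞) → ℝ satisfy 0 < C(t) ≤ 1 for all t, C(0) = 1, and for all reals 0 ≤ a < b, C(b·t)/C(a·t) → 0 as t → ∞. Fix σ² > 0, a dimension d, points x0, x1, …, xn ∈ ℝ^d, an index ℓ ∈ {1,…,d}, fixed positive length-scales θᵢ for i ≠ ℓ, and define K_θ(u, v) := σ²·∏_{i=1}^d C(|uᵢ − vᵢ|/θᵢ). Suppose j is such that |x0ℓ − xjℓ| < |x0ℓ − xlℓ| for every l ≠ j. Then for every l ≠ j, the ratio K_θ(x0, xl)/K_θ(x0, xj) → 0 as θℓ → 0⁺; equivalently, the normalized covariance vector (1/K_θ(x0, xj))·k_θ(x0) converges to the j-th standard unit vector e_j ∈ ℝⁿ. -/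
open Filter Topology

/-- A tensor-product kernel splits off the factor of the coordinate `ℓ`. -/
theorem tensor_kernel_split {d : ℕ} (C : ℝ → ℝ) (σ2 s : ℝ) (u v θ : Fin d → ℝ) (ℓ : Fin d) :
    σ2 * ∏ i, C (|u i - v i| / Function.update θ ℓ s i) =
      (σ2 * ∏ i ∈ Finset.univ.erase ℓ, C (|u i - v i| / θ i)) * C (|u ℓ - v ℓ| * s⁻¹) := by
  rw [← Finset.mul_prod_erase _ _ (Finset.mem_univ ℓ), Function.update_self, div_eq_mul_inv,
    Finset.prod_congr rfl fun i hi => by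
      rw [Function.update_of_ne (Finset.ne_of_mem_erase hi)]]
  ring

/-- For a tensor-product kernel with a strictly decaying one-dimensional kernel `C`, as the
length-scale `θℓ → 0⁺`, the covariance of `x0` with any observation `x l` becomes
negligible compared to the covariance with the (coordinate-wise) closest observation `x j`;
equivalently, the normalized covariance vector converges to the standard unit vector `e_j`. -/
theorem covariance_vector_localizes (d n : ℕ) (C : ℝ → ℝ)
    (hCpos : ∀ t : ℝ, 0 ≤ t → 0 < C t ∧ C t ≤ 1) (hC0 : C 0 = 1)
    (hdecay : ∀ a b : ℝ, 0 ≤ a → a < b →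
      Tendsto (fun t => C (b * t) / C (a * t)) atTop (𝓝 0))
    (σ2 : ℝ) (hσ2 : 0 < σ2)
    (x0 : Fin d → ℝ) (x : Fin n → Fin d → ℝ) (ℓ : Fin d)
    (θ : Fin d → ℝ) (hθ : ∀ i, i ≠ ℓ → 0 < θ i)
    (j : Fin n) (hj : ∀ l, l ≠ j → |x0 ℓ - x j ℓ| < |x0 ℓ - x l ℓ|)
    (Kf : ℝ → (Fin d → ℝ) → (Fin d → ℝ) → ℝ)
    (hKf : Kf = fun s u v => σ2 * ∏ i, C (|u i - v i| / Function.update θ ℓ s i)) :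
    (∀ l, l ≠ j →
      Tendsto (fun s => Kf s x0 (x l) / Kf s x0 (x j)) (𝓝[>] 0) (𝓝 0)) ∧
    Tendsto (fun s => (Kf s x0 (x j))⁻¹ • (fun i => Kf s x0 (x i)))
      (𝓝[>] 0) (𝓝 (Pi.single j 1)) := by
  have hratio : ∀ l, l ≠ j →
      Tendsto (fun s => Kf s x0 (x l) / Kf s x0 (x j)) (𝓝[>] 0) (𝓝 0) := by
    intro l hl
    have hlim := ((hdecay _ _ (abs_nonneg _) (hj l hl)).comp
      tendsto_inv_nhdsGT_zero).const_mul
      ((σ2 * ∏ i ∈ Finset.univ.erase ℓ, C (|x0 i - x l i| / θ i)) /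
        (σ2 * ∏ i ∈ Finset.univ.erase ℓ, C (|x0 i - x j i| / θ i)))
    rw [mul_zero] at hlim
    refine hlim.congr fun s => ?_
    simp only [hKf, tensor_kernel_split, Function.comp_apply]
    exact div_mul_div_comm _ _ _ _
  refine ⟨hratio, tendsto_pi_nhds.2 fun l => ?_⟩
  rcases eq_or_ne l j with rfl | hl
  · rw [Pi.single_eq_same]
    refine tendsto_const_nhds.congr' ?_
    filter_upwards [self_mem_nhdsWithin] with s hs
    have hs : 0 < s := hs
    have hpos : 0 < Kf s x0 (x l) := by
      rw [hKf]
      refine mul_pos hσ2 (Finset.prod_pos fun i _ => (hCpos _ (div_nonneg (abs_nonneg _) ?_)).1)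
      rcases eq_or_ne i ℓ with rfl | hi
      · simpa using hs.le
      · simpa [Function.update_of_ne hi] using (hθ i hi).le
    simp [inv_mul_cancel₀ hpos.ne']
  · rw [Pi.single_eq_of_ne hl]
    exact (hratio l hl).congr fun s => by simp [div_eq_inv_mul]
end

section
/- Let C : [0,∞) → ℝ satisfy 0 < C(t) ≤ 1 for all t, C(0) = 1, and for all reals 0 ≤ a < b, C(b·t)/C(a·t) → 0 as t → ∞. Fix σ² > 0, points x1, …, xn ∈ ℝ^d whose ℓ-th coordinates are pairwise distinct, fixed positive θᵢ for i ≠ ℓ, and define the Gram matrix K_θ and covariance vector k_θ(x0) from the tensor-product kernel K_θ(u,v) = σ²·∏ᵢC(|uᵢ−vᵢ|/θᵢ); assume K_θ is positive definite for all sufficiently small θℓ > 0. Let x0 ∈ ℝ^d satisfy |x0ℓ − xjℓ| < |x0ℓ − xlℓ| for every l ≠ j. Then, for any y ∈ ℝⁿ and β ∈ ℝ, the SiNK prediction β + (σ/√(k_θ(x0)ᵀK_θ⁻¹k_θ(x0)))·k_θ(x0)ᵀK_θ⁻¹(y − β·1) converges to y_j as θℓ → 0⁺ (localness of SiNK: the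 prediction converges to the observed value at the closest point). -/
open Filter Topology Matrix

/-- The normalized linear predictor with weights `A *ᵥ v` is invariant under positive rescaling
of `v`, so its limit depends only on the limiting direction of `v`. -/
theorem tendsto_normalized_predictor {ι α : Type*} [Fintype ι] [DecidableEq ι] {F : Filter α}
    {σ2 : ℝ} (hσ2 : 0 < σ2) {K : α → Matrix ι ι ℝ} (hK : Tendsto K F (𝓝 (σ2 • 1)))
    {v : α → ι → ℝ} {j : ι} (hpos : ∀ᶠ s in F, 0 < v s j)
    (hv : ∀ l, l ≠ j → Tendsto (fun s => v s l / v s j) F (𝓝 0)) (z : ι → ℝ) :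
    Tendsto (fun s => Real.sqrt σ2 / Real.sqrt (v s ⬝ᵥ ((K s)⁻¹ *ᵥ v s)) *
      (v s ⬝ᵥ ((K s)⁻¹ *ᵥ z))) F (𝓝 (z j)) := by
  have hinv_limit : (σ2 • (1 : Matrix ι ι ℝ))⁻¹ = σ2⁻¹ • 1 := by
    apply Matrix.inv_eq_right_inv
    simp [smul_smul, hσ2.ne']
  have hdet : (σ2 • (1 : Matrix ι ι ℝ)).det ≠ 0 := by
    simp [hσ2.ne']
  have hinv : Tendsto (fun s => (K s)⁻¹) F (𝓝 (σ2⁻¹ • 1)) := by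
    rw [← hinv_limit]
    simp only [Matrix.inv_def, Ring.inverse_eq_inv']
    exact (((continuous_id.matrix_det.tendsto _).comp hK).inv₀ hdet).smul
      ((continuous_id.matrix_adjugate.tendsto _).comp hK)
  set w : α → ι → ℝ := fun s => (v s j)⁻¹ • v s with hw
  have hwlim : Tendsto w F (𝓝 (Pi.single j 1)) := by
    rw [tendsto_pi_nhds]
    intro l
    by_cases hl : l = j
    · subst hl
      rw [Pi.single_eq_same]
      refine tendsto_const_nhds.congr' ?_
      filter_upwards [hpos] with s hs
      simp [hw, hs.ne']
    · rw [Pi.single_eq_of_ne hl]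
      refine (hv l hl).congr fun s => ?_
      simp [hw, div_eq_inv_mul]
  have hform : ∀ u : α → ι → ℝ, ∀ u0 : ι → ℝ, Tendsto u F (𝓝 u0) →
      Tendsto (fun s => w s ⬝ᵥ ((K s)⁻¹ *ᵥ u s)) F (𝓝 (σ2⁻¹ * u0 j)) := by
    intro u u0 hu
    have hcont : Continuous fun p : (ι → ℝ) × Matrix ι ι ℝ × (ι → ℝ) =>
        p.1 ⬝ᵥ (p.2.1 *ᵥ p.2.2) :=
      continuous_fst.dotProduct
        (continuous_snd.fst.matrix_mulVec continuous_snd.snd)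
    have h := (hcont.tendsto (Pi.single j 1, σ2⁻¹ • 1, u0)).comp
      (hwlim.prodMk_nhds (hinv.prodMk_nhds hu))
    simpa [Function.comp_def, Matrix.smul_mulVec] using h
  have hq := hform w _ hwlim
  have hr := hform (fun _ => z) z tendsto_const_nhds
  rw [Pi.single_eq_same, mul_one] at hq
  have hlim := ((tendsto_const_nhds (x := Real.sqrt σ2)).div hq.sqrt
    (Real.sqrt_pos.2 (inv_pos.2 hσ2)).ne').mul hr
  have hval : Real.sqrt σ2 / Real.sqrt σ2⁻¹ * (σ2⁻¹ * z j) = z j := by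
    rw [Real.sqrt_inv, div_inv_eq_mul, Real.mul_self_sqrt hσ2.le, mul_inv_cancel_left₀ hσ2.ne']
  rw [hval] at hlim
  refine hlim.congr' ?_
  filter_upwards [hpos] with s hs
  have hvw : v s = v s j • w s := by simp [hw, smul_smul, hs.ne']
  rw [show v s ⬝ᵥ ((K s)⁻¹ *ᵥ v s) = v s j * v s j * (w s ⬝ᵥ ((K s)⁻¹ *ᵥ w s)) by
      conv_lhs => rw [hvw]
      simp [Matrix.mulVec_smul, mul_assoc],
    show v s ⬝ᵥ ((K s)⁻¹ *ᵥ z) = v s j * (w s ⬝ᵥ ((K s)⁻¹ *ᵥ z)) by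
      conv_lhs => rw [hvw]
      simp]
  rw [Pi.div_apply, Real.sqrt_mul (mul_self_nonneg _), Real.sqrt_mul_self hs.le]
  field_simp

/-- A tensor-product kernel factors into its `ℓ`-th component and the remaining components,
which do not depend on the `ℓ`-th length scale. -/
theorem prod_kernel_update {ι : Type*} [Fintype ι] [DecidableEq ι] (C : ℝ → ℝ) (u : ι → ℝ)
    (θ : ι → ℝ) (ℓ : ι) (s : ℝ) :
    ∏ i, C (u i / Function.update θ ℓ s i) =
      C (u ℓ / s) * ∏ i ∈ Finset.univ.erase ℓ, C (u i / θ i) := by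
  rw [← Finset.mul_prod_erase Finset.univ _ (Finset.mem_univ ℓ), Function.update_self]
  congr 1
  refine Finset.prod_congr rfl fun i hi => ?_
  rw [Function.update_of_ne (Finset.ne_of_mem_erase hi)]

/-- Localness of SiNK: for a tensor-product kernel with strictly decaying one-dimensional
kernel `C`, if `x j` is the strictly closest observation to `x0` in the `ℓ`-th coordinate,
then the SiNK prediction at `x0` converges to the observed value `y j` as `θℓ → 0⁺`. -/
theorem sink_localness (d n : ℕ) (C : ℝ → ℝ)
    (hCpos : ∀ t : ℝ, 0 ≤ t → 0 < C t ∧ C t ≤ 1) (hC0 : C 0 = 1)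
    (hdecay : ∀ a b : ℝ, 0 ≤ a → a < b →
      Tendsto (fun t => C (b * t) / C (a * t)) atTop (𝓝 0))
    (σ2 : ℝ) (hσ2 : 0 < σ2)
    (x : Fin n → Fin d → ℝ) (ℓ : Fin d)
    (hinj : Function.Injective fun j => x j ℓ)
    (θ : Fin d → ℝ) (hθ : ∀ i, i ≠ ℓ → 0 < θ i)
    (Kmat : ℝ → Matrix (Fin n) (Fin n) ℝ)
    (hKmat : Kmat = fun s => Matrix.of fun j l =>
      σ2 * ∏ i, C (|x j i - x l i| / Function.update θ ℓ s i))
    (hPD : ∃ s0 > (0 : ℝ), ∀ s : ℝ, 0 < s → s < s0 → (Kmat s).PosDef)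
    (x0 : Fin d → ℝ) (j : Fin n)
    (hj : ∀ l, l ≠ j → |x0 ℓ - x j ℓ| < |x0 ℓ - x l ℓ|)
    (kvec : ℝ → Fin n → ℝ)
    (hkvec : kvec = fun s i => σ2 * ∏ i' , C (|x0 i' - x i i'| / Function.update θ ℓ s i'))
    (y : Fin n → ℝ) (β : ℝ) :
    Tendsto (fun s => β + (Real.sqrt σ2 / Real.sqrt (kvec s ⬝ᵥ ((Kmat s)⁻¹ *ᵥ kvec s))) *
        (kvec s ⬝ᵥ ((Kmat s)⁻¹ *ᵥ (y - β • (1 : Fin n → ℝ)))))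
      (𝓝[>] 0) (𝓝 (y j)) := by
  have hratio : ∀ a b : ℝ, 0 ≤ a → a < b →
      Tendsto (fun s => C (b / s) / C (a / s)) (𝓝[>] 0) (𝓝 0) := fun a b ha hab => by
    simpa only [Function.comp_def, div_eq_mul_inv] using
      (hdecay a b ha hab).comp tendsto_inv_nhdsGT_zero
  have hCpos' : ∀ (r s : ℝ), 0 < s → 0 < C (|r| / s) := fun r s hs =>
    (hCpos _ (by positivity)).1
  have hrest : ∀ u v : Fin d → ℝ, 0 < ∏ i ∈ Finset.univ.erase ℓ, C (|u i - v i| / θ i) :=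
    fun u v => Finset.prod_pos fun i hi => hCpos' _ _ (hθ i (Finset.ne_of_mem_erase hi))
  have hK : Tendsto Kmat (𝓝[>] 0) (𝓝 (σ2 • 1)) := by
    refine tendsto_pi_nhds.2 fun p => tendsto_pi_nhds.2 fun q => ?_
    rw [hKmat]
    by_cases hpq : p = q
    · subst hpq
      simp [hC0]
    · have hdist : 0 < |x p ℓ - x q ℓ| := abs_pos.2 (sub_ne_zero.2 fun h => hpq (hinj h))
      simp only [Matrix.of_apply, Matrix.smul_apply, Matrix.one_apply_ne hpq, smul_zero]
      simp_rw [prod_kernel_update C (fun i => |x p i - x q i|)]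
      simpa [hC0] using ((hratio 0 _ le_rfl hdist).mul_const
        (∏ i ∈ Finset.univ.erase ℓ, C (|x p i - x q i| / θ i))).const_mul σ2
  have hkpos : ∀ᶠ s in 𝓝[>] (0 : ℝ), 0 < kvec s j := by
    filter_upwards [self_mem_nhdsWithin] with s hs
    rw [hkvec]
    simp only [prod_kernel_update C (fun i => |x0 i - x j i|)]
    exact mul_pos hσ2 (mul_pos (hCpos' _ _ hs) (hrest _ _))
  have hk : ∀ l, l ≠ j → Tendsto (fun s => kvec s l / kvec s j) (𝓝[>] 0) (𝓝 0) := by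
    intro l hl
    have h := (hratio _ _ (abs_nonneg _) (hj l hl)).mul_const
      ((∏ i ∈ Finset.univ.erase ℓ, C (|x0 i - x l i| / θ i)) /
        ∏ i ∈ Finset.univ.erase ℓ, C (|x0 i - x j i| / θ i))
    rw [zero_mul] at h
    refine h.congr fun s => ?_
    simp only [hkvec, prod_kernel_update C (fun i => |x0 i - x l i|),
      prod_kernel_update C (fun i => |x0 i - x j i|)]
    rw [mul_div_mul_left _ _ hσ2.ne', mul_div_mul_comm]
  simpa using (tendsto_normalized_predictor hσ2 hK hkpos hk (y - β • 1)).const_add β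
end
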